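/- arXiv:2211.06530 — 7 statements merged into one kernel-verified Lean document; each statement's English description precedes it below -/
import Mathlib

section
/- Let n, k, d ≥ 1 and let C be a real n×k matrix satisfying ‖Cu‖₂ ≤ 1 for every vector u ∈ {−1, 1}^k, and suppose in addition that every entry of the matrix CᵀC is nonnegative. Then for every real k×d matrix G each of whose rows has ℓ₂-norm at most 1, one has ‖CG‖_F ≤ 1. -/
open Matrix

/-- Euclidean norm of a finite real vector. -/
noncomputable def eucNorm {m : ℕ} (x : Fin m → ℝ) : ℝ :=
  Real.sqrt (∑ i, (x i) ^ 2)

/-- Frobenius norm of a real matrix. -/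
noncomputable def frobNorm {m l : ℕ} (M : Matrix (Fin m) (Fin l) ℝ) : ℝ :=
  Real.sqrt (∑ i, ∑ j, (M i j) ^ 2)

/-- The squared Frobenius norm of `C * G` pairs the Gram matrices of the columns of `C` and of the
rows of `G`. -/
theorem sum_sq_mul_eq_sum_gram {m k l : ℕ}
    (C : Matrix (Fin m) (Fin k) ℝ) (G : Matrix (Fin k) (Fin l) ℝ) :
    ∑ i, ∑ j, ((C * G) i j) ^ 2 = ∑ a, ∑ b, (G a ⬝ᵥ G b) * (Cᵀ * C) b a := by
  have hfrob : ∑ i, ∑ j, ((C * G) i j) ^ 2 = ((C * G) * (C * G)ᵀ).trace := by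
    simp only [trace, diag_apply, mul_apply (M := C * G), transpose_apply, sq]
  have hcyc : ((C * G) * (C * G)ᵀ).trace = ((G * Gᵀ) * (Cᵀ * C)).trace := by
    rw [transpose_mul, Matrix.mul_assoc, Matrix.trace_mul_comm]
    simp only [Matrix.mul_assoc]
  rw [hfrob, hcyc]
  simp only [trace, diag_apply, mul_apply (M := G * Gᵀ)]
  rfl

/-- Vectors of Euclidean norm at most one have inner product at most one. -/
theorem dotProduct_le_one_of_eucNorm_le_one {m : ℕ} {x y : Fin m → ℝ}
    (hx : eucNorm x ≤ 1) (hy : eucNorm y ≤ 1) : x ⬝ᵥ y ≤ 1 :=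
  (Real.sum_mul_le_sqrt_mul_sqrt Finset.univ x y).trans
    (mul_le_one₀ hx (Real.sqrt_nonneg _) hy)

theorem frobenius_bound_of_sign_vectors_nonneg_gram
    (n k d : ℕ) (hn : 1 ≤ n) (hk : 1 ≤ k) (hd : 1 ≤ d)
    (C : Matrix (Fin n) (Fin k) ℝ)
    (hC : ∀ u : Fin k → ℝ, (∀ i, u i = 1 ∨ u i = -1) → eucNorm (C.mulVec u) ≤ 1)
    (hCC : ∀ i j, 0 ≤ (Cᵀ * C) i j)
    (G : Matrix (Fin k) (Fin d) ℝ)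
    (hG : ∀ i : Fin k, eucNorm (G i) ≤ 1) :
    frobNorm (C * G) ≤ 1 := by
  have hones : ∑ i, (C.mulVec (fun _ => 1) i) ^ 2 = ∑ a, ∑ b, (Cᵀ * C) b a := by
    simpa [mul_apply (M := C) (N := Matrix.of fun _ _ => _), mulVec, dotProduct] using
      sum_sq_mul_eq_sum_gram C (Matrix.of fun _ (_ : Fin 1) => 1)
  refine le_trans (Real.sqrt_le_sqrt ?_) (hC (fun _ => 1) fun _ => Or.inl rfl)
  rw [sum_sq_mul_eq_sum_gram, hones]
  exact Finset.sum_le_sum fun a _ => Finset.sum_le_sum fun b _ =>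
    mul_le_of_le_one_left (hCC b a) (dotProduct_le_one_of_eucNorm_le_one (hG a) (hG b))
end

section
/- Let n, k, d ≥ 1 and let C be a real n×k matrix satisfying ‖Cu‖₂ ≤ 1 for every vector u ∈ {−1, 1}^k. Let G be a real k×d matrix each of whose rows has ℓ₂-norm at most 1, and suppose the rows of G are pairwise orthogonal: ⟨G_{[i,:]}, G_{[j,:]}⟩ = 0 for all i ≠ j. Then ‖CG‖_F ≤ 1. -/
open Matrix

/-- Some signed sum of vectors is at least as long as the root of the sum of their squared norms. -/
theorem exists_signs_sum_norm_sq_le {ι E : Type*} [NormedAddCommGroup E] [InnerProductSpace ℝ E]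
    (v : ι → E) (s : Finset ι) :
    ∃ u : ι → ℝ, (∀ i, u i = 1 ∨ u i = -1) ∧
      ∑ i ∈ s, ‖v i‖ ^ 2 ≤ ‖∑ i ∈ s, u i • v i‖ ^ 2 := by
  classical
  induction s using Finset.induction_on with
  | empty => exact ⟨fun _ => 1, by simp, by simp⟩
  | insert a s ha ih =>
    obtain ⟨u, hu, hle⟩ := ih
    have key : ∀ c : ℝ, ∑ i ∈ insert a s, Function.update u a c i • v i
        = c • v a + ∑ i ∈ s, u i • v i := by
      intro c
      rw [Finset.sum_insert ha, Function.update_self]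
      congr 1
      refine Finset.sum_congr rfl fun i hi => ?_
      rw [Function.update_of_ne (ne_of_mem_of_not_mem hi ha)]
    have hsign : ∀ c : ℝ, (c = 1 ∨ c = -1) →
        ∀ i, Function.update u a c i = 1 ∨ Function.update u a c i = -1 := by
      intro c hc i
      by_cases h : i = a
      · subst h
        simpa using hc
      · simpa [Function.update_of_ne h] using hu i
    have expand : ∀ c : ℝ, (c = 1 ∨ c = -1) → ‖c • v a + ∑ i ∈ s, u i • v i‖ ^ 2
        = ‖v a‖ ^ 2 + 2 * (c * inner ℝ (v a) (∑ i ∈ s, u i • v i))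
          + ‖∑ i ∈ s, u i • v i‖ ^ 2 := by
      intro c hc
      rw [norm_add_sq_real, real_inner_smul_left, norm_smul]
      rcases hc with rfl | rfl <;> simp
    rw [Finset.sum_insert ha]
    rcases le_total 0 (inner ℝ (v a) (∑ i ∈ s, u i • v i)) with h | h
    · refine ⟨Function.update u a 1, hsign 1 (.inl rfl), ?_⟩
      rw [key, expand 1 (.inl rfl)]
      linarith
    · refine ⟨Function.update u a (-1), hsign (-1) (.inr rfl), ?_⟩
      rw [key, expand (-1) (.inr rfl)]
      linarith

/-- Pythagoras for a linear combination of orthogonal rows. -/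
theorem sum_vecMul_sq_of_orthogonal_rows {κ δ : Type*} [Fintype κ] [Fintype δ]
    (c : κ → ℝ) (G : Matrix κ δ ℝ)
    (horth : ∀ i j, i ≠ j → ∑ l, G i l * G j l = 0) :
    ∑ l, (∑ i, c i * G i l) ^ 2 = ∑ i, c i ^ 2 * ∑ l, G i l ^ 2 := by
  classical
  calc ∑ l, (∑ i, c i * G i l) ^ 2
      = ∑ l, ∑ i, ∑ j, c i * c j * (G i l * G j l) := by
        refine Finset.sum_congr rfl fun l _ => ?_
        rw [sq, Finset.sum_mul_sum]
        exact Finset.sum_congr rfl fun i _ => Finset.sum_congr rfl fun j _ => by ring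
    _ = ∑ i, ∑ j, c i * c j * ∑ l, G i l * G j l := by
        rw [Finset.sum_comm]
        refine Finset.sum_congr rfl fun i _ => ?_
        rw [Finset.sum_comm]
        simp only [Finset.mul_sum]
    _ = ∑ i, c i ^ 2 * ∑ l, G i l ^ 2 := by
        refine Finset.sum_congr rfl fun i _ => ?_
        rw [Finset.sum_eq_single i (fun j _ hj => by rw [horth i j hj.symm, mul_zero]) (by simp)]
        simp only [sq]

theorem frobenius_bound_of_sign_vectors_orthogonal_rows
    (n k d : ℕ) (hn : 1 ≤ n) (hk : 1 ≤ k) (hd : 1 ≤ d)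
    (C : Matrix (Fin n) (Fin k) ℝ)
    (hC : ∀ u : Fin k → ℝ, (∀ i, u i = 1 ∨ u i = -1) → eucNorm (C.mulVec u) ≤ 1)
    (G : Matrix (Fin k) (Fin d) ℝ)
    (hG : ∀ i : Fin k, eucNorm (G i) ≤ 1)
    (horth : ∀ i j : Fin k, i ≠ j → ∑ l, G i l * G j l = 0) :
    frobNorm (C * G) ≤ 1 := by
  obtain ⟨u, hu, hle⟩ :=
    exists_signs_sum_norm_sq_le (fun i => WithLp.toLp 2 (Cᵀ i)) Finset.univ
  have hCu := hC u hu
  rw [eucNorm, Real.sqrt_le_one] at hCu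
  simp only [EuclideanSpace.real_norm_sq_eq, WithLp.ofLp_sum, WithLp.ofLp_smul, Finset.sum_apply,
    Pi.smul_apply, transpose_apply, smul_eq_mul] at hle
  rw [frobNorm, Real.sqrt_le_one]
  calc ∑ r, ∑ l, (C * G) r l ^ 2
      = ∑ r, ∑ i, C r i ^ 2 * ∑ l, G i l ^ 2 := by
        refine Finset.sum_congr rfl fun r _ => ?_
        simp only [mul_apply]
        exact sum_vecMul_sq_of_orthogonal_rows (C r) G horth
    _ ≤ ∑ r, ∑ i, C r i ^ 2 := by
        refine Finset.sum_le_sum fun r _ => Finset.sum_le_sum fun i _ => ?_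
        exact mul_le_of_le_one_right (sq_nonneg _) (Real.sqrt_le_one.mp (hG i))
    _ = ∑ i, ∑ r, C r i ^ 2 := Finset.sum_comm
    _ ≤ ∑ r, (∑ i, u i * C r i) ^ 2 := hle
    _ = ∑ r, (C *ᵥ u) r ^ 2 := by
        simp only [mulVec, dotProduct, mul_comm]
    _ ≤ 1 := hCu
end

section
/- Let n, k, d ≥ 1 and let C be a real n×k matrix satisfying ‖Cu‖₂ ≤ 1 for every vector u ∈ {−1, 1}^k. Then for every real k×d matrix G each of whose rows has ℓ₂-norm at most 1, one has ‖CG‖_F ≤ π/2. -/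
open Matrix

open MeasureTheory ProbabilityTheory
open scoped RealInnerProductSpace

theorem integral_abs_gaussianReal_zero_one :
    ∫ x, |x| ∂(gaussianReal 0 1) = √(2 / Real.pi) := by
  have half_line : ∫ x in Set.Ioi (0 : ℝ), x * Real.exp (-(1 / 2) * x ^ 2) = 1 := by
    have h := integral_rpow_mul_exp_neg_mul_rpow (p := 2) (q := 1) (b := 1 / 2)
      (by norm_num) (by norm_num) (by norm_num)
    norm_num [Real.rpow_neg_one] at h
    simpa [neg_mul] using h
  have line : ∫ x : ℝ, |x| * Real.exp (-(1 / 2) * |x| ^ 2) = 2 := by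
    rw [integral_comp_abs (f := fun x ↦ x * Real.exp (-(1 / 2) * x ^ 2)), half_line, mul_one]
  rw [integral_gaussianReal_eq_integral_smul one_ne_zero]
  have pdf : ∀ x : ℝ, gaussianPDFReal 0 1 x • |x| =
      (√(2 * Real.pi))⁻¹ * (|x| * Real.exp (-(1 / 2) * |x| ^ 2)) := by
    intro x
    simp only [gaussianPDFReal, NNReal.coe_one, mul_one, sub_zero, sq_abs, smul_eq_mul]
    ring_nf
  simp_rw [pdf]
  rw [integral_const_mul, line, eq_comm, Real.sqrt_eq_iff_mul_self_eq (by positivity) (by positivity)]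
  field_simp
  rw [Real.sq_sqrt (by positivity)]

section StdGaussian

variable {E : Type*} [NormedAddCommGroup E] [InnerProductSpace ℝ E] [FiniteDimensional ℝ E]
  [MeasurableSpace E] [BorelSpace E]

theorem memLp_two_inner_stdGaussian (h : E) :
    MemLp (fun x ↦ ⟪h, x⟫) 2 (stdGaussian E) :=
  IsGaussian.memLp_dual (stdGaussian E) (innerSL ℝ h) 2 (by simp)

theorem integral_inner_sq_stdGaussian (h : E) :
    ∫ x, ⟪h, x⟫ ^ 2 ∂(stdGaussian E) = ‖h‖ ^ 2 := by
  have hv := variance_dual_stdGaussian (innerSL ℝ h)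
  rw [variance_of_integral_eq_zero (innerSL ℝ h).continuous.aemeasurable
    (integral_strongDual_stdGaussian _)] at hv
  simpa using hv

theorem integral_abs_inner_stdGaussian {e : E} (he : ‖e‖ = 1) :
    ∫ x, |⟪e, x⟫| ∂(stdGaussian E) = √(2 / Real.pi) := by
  have law : (stdGaussian E).map (innerSL ℝ e) = gaussianReal 0 1 := by
    rw [IsGaussian.map_eq_gaussianReal, integral_strongDual_stdGaussian,
      variance_dual_stdGaussian]
    simp [he]
  rw [← integral_abs_gaussianReal_zero_one, ← law,
    integral_map (innerSL ℝ e).continuous.aemeasurable (by fun_prop)]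
  simp

theorem measurable_real_sign : Measurable Real.sign := by
  unfold Real.sign
  exact Measurable.ite measurableSet_Iio measurable_const
    (Measurable.ite measurableSet_Ioi measurable_const measurable_const)

theorem abs_real_sign_le_one (x : ℝ) : |Real.sign x| ≤ 1 := by
  rcases Real.sign_apply_eq x with h | h | h <;> simp [h]

theorem memLp_sign_inner_stdGaussian (g : E) :
    MemLp (fun x ↦ Real.sign ⟪g, x⟫) 2 (stdGaussian E) :=
  MemLp.of_bound (measurable_real_sign.comp (by fun_prop)).aestronglyMeasurable 1
    (.of_forall fun _ ↦ abs_real_sign_le_one _)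

theorem integral_sign_inner_mul_inner_stdGaussian_of_norm_eq_one {e : E} (he : ‖e‖ = 1) (h : E) :
    ∫ x, Real.sign ⟪e, x⟫ * ⟪h, x⟫ ∂(stdGaussian E) = √(2 / Real.pi) * ⟪e, h⟫ := by
  set R := (ℝ ∙ e).reflection
  have hR (x : E) : R x = (2 * ⟪e, x⟫) • e - x := by
    simp [R, Submodule.reflection_singleton_apply, he, mul_smul, two_smul]
  have hee : ⟪e, e⟫ = 1 := by simp [he]
  have hint : Integrable (fun x ↦ Real.sign ⟪e, x⟫ * ⟪h, x⟫) (stdGaussian E) :=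
    (memLp_sign_inner_stdGaussian e).integrable_mul (memLp_two_inner_stdGaussian h)
  have reflect : ∫ x, Real.sign ⟪e, x⟫ * ⟪h, x⟫ ∂(stdGaussian E) =
      ∫ x, (2 * ⟪e, h⟫ * |⟪e, x⟫| - Real.sign ⟪e, x⟫ * ⟪h, x⟫) ∂(stdGaussian E) := by
    conv_lhs => rw [← stdGaussian_map R]
    rw [integral_map R.continuous.aemeasurable (by rw [stdGaussian_map R]; exact hint.1)]
    refine integral_congr_ae (.of_forall fun x ↦ ?_)
    have hs : |⟪e, x⟫| = Real.sign ⟪e, x⟫ * ⟪e, x⟫ := by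
      rcases lt_trichotomy ⟪e, x⟫ 0 with hx | hx | hx
      · rw [Real.sign_of_neg hx, abs_of_neg hx]; ring
      · simp [hx]
      · rw [Real.sign_of_pos hx, abs_of_pos hx]; ring
    simp only [hR, inner_sub_right, real_inner_smul_right, hee, hs, real_inner_comm e h]
    ring_nf
  have habs := ((memLp_two_inner_stdGaussian e).integrable (by norm_num)).abs
  rw [integral_sub (habs.const_mul _) hint, integral_const_mul,
    integral_abs_inner_stdGaussian he] at reflect
  linarith

theorem integral_norm_mul_sign_inner_mul_inner_stdGaussian (g h : E) :
    ∫ x, ‖g‖ * Real.sign ⟪g, x⟫ * ⟪h, x⟫ ∂(stdGaussian E) = √(2 / Real.pi) * ⟪g, h⟫ := by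
  rcases eq_or_ne g 0 with rfl | hg
  · simp
  have hpos : 0 < ‖g‖ := norm_pos_iff.2 hg
  have hunit := integral_sign_inner_mul_inner_stdGaussian_of_norm_eq_one
    (norm_smul_inv_norm (𝕜 := ℝ) hg) h
  have hsign (x : E) : Real.sign (‖g‖⁻¹ * ⟪g, x⟫) = Real.sign ⟪g, x⟫ := by
    rcases lt_trichotomy ⟪g, x⟫ 0 with hx | hx | hx
    · rw [Real.sign_of_neg hx, Real.sign_of_neg (mul_neg_of_pos_of_neg (by positivity) hx)]
    · simp [hx]
    · rw [Real.sign_of_pos hx, Real.sign_of_pos (by positivity)]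
  simp only [RCLike.ofReal_real_eq_id, id_eq, real_inner_smul_left, hsign] at hunit
  simp_rw [mul_assoc]
  rw [integral_const_mul, hunit]
  field_simp

/-- Bessel's inequality against the coordinate functionals of the standard Gaussian. -/
theorem norm_sq_le_integral_sq_of_integral_mul_inner {f : E → ℝ} (hf : MemLp f 2 (stdGaussian E))
    (w : E) (hw : ∀ h, ∫ x, f x * ⟪h, x⟫ ∂(stdGaussian E) = ⟪w, h⟫) :
    ‖w‖ ^ 2 ≤ ∫ x, f x ^ 2 ∂(stdGaussian E) := by
  have hL := memLp_two_inner_stdGaussian w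
  have hnonneg : 0 ≤ ∫ x, (f x ^ 2 - 2 * (f x * ⟪w, x⟫) + ⟪w, x⟫ ^ 2) ∂(stdGaussian E) :=
    integral_nonneg fun x ↦ by
      simp only [Pi.zero_apply]
      nlinarith [sq_nonneg (f x - ⟪w, x⟫)]
  have hfL : Integrable (fun x ↦ 2 * (f x * ⟪w, x⟫)) (stdGaussian E) :=
    (hf.integrable_mul hL).const_mul 2
  have hsub : Integrable (fun x ↦ f x ^ 2 - 2 * (f x * ⟪w, x⟫)) (stdGaussian E) :=
    hf.integrable_sq.sub hfL
  rw [integral_add hsub hL.integrable_sq,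
    integral_sub hf.integrable_sq hfL, integral_const_mul, hw,
    integral_inner_sq_stdGaussian, real_inner_self_eq_norm_sq] at hnonneg
  linarith

end StdGaussian

theorem eucNorm_eq_norm_toLp {m : ℕ} (x : Fin m → ℝ) : eucNorm x = ‖WithLp.toLp 2 x‖ := by
  simp [eucNorm, EuclideanSpace.norm_eq]

/-- A bound on the sign vectors extends to the whole cube by convexity. -/
theorem eucNorm_mulVec_le_one_of_abs_le_one {n k : ℕ} {C : Matrix (Fin n) (Fin k) ℝ}
    (hC : ∀ u : Fin k → ℝ, (∀ i, u i = 1 ∨ u i = -1) → eucNorm (C.mulVec u) ≤ 1)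
    {u : Fin k → ℝ} (hu : ∀ i, |u i| ≤ 1) : eucNorm (C.mulVec u) ≤ 1 := by
  let T : (Fin k → ℝ) →ₗ[ℝ] EuclideanSpace ℝ (Fin n) :=
    (WithLp.linearEquiv 2 ℝ (Fin n → ℝ)).symm.toLinearMap ∘ₗ C.mulVecLin
  have hT (v : Fin k → ℝ) : eucNorm (C.mulVec v) = ‖T v‖ := eucNorm_eq_norm_toLp _
  have hconv : Convex ℝ (T ⁻¹' Metric.closedBall 0 1) :=
    (convex_closedBall _ _).linear_preimage T
  have hsub : (Set.univ.pi fun _ : Fin k ↦ ({-1, 1} : Set ℝ)) ⊆ T ⁻¹' Metric.closedBall 0 1 := by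
    intro v hv
    simpa [← hT] using hC v fun i ↦ (hv i trivial).symm
  have hmem : u ∈ convexHull ℝ (Set.univ.pi fun _ : Fin k ↦ ({-1, 1} : Set ℝ)) := by
    rw [convexHull_pi]
    intro i _
    rw [convexHull_pair, segment_eq_Icc (by norm_num)]
    exact abs_le.1 (hu i)
  simpa [hT] using convexHull_min hsub hconv hmem

/-- The sharper bound `√(π / 2)`, in squared form. -/
theorem sum_sq_mul_le_pi_div_two {n k d : ℕ} {C : Matrix (Fin n) (Fin k) ℝ}
    (hC : ∀ u : Fin k → ℝ, (∀ i, u i = 1 ∨ u i = -1) → eucNorm (C.mulVec u) ≤ 1)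
    {G : Matrix (Fin k) (Fin d) ℝ} (hG : ∀ i : Fin k, eucNorm (G i) ≤ 1) :
    ∑ a, ∑ j, (C * G) a j ^ 2 ≤ Real.pi / 2 := by
  set μ := stdGaussian (EuclideanSpace ℝ (Fin d))
  let g (i : Fin k) : EuclideanSpace ℝ (Fin d) := WithLp.toLp 2 (G i)
  let s (x : EuclideanSpace ℝ (Fin d)) (i : Fin k) : ℝ := ‖g i‖ * Real.sign ⟪g i, x⟫
  have hs (i : Fin k) : MemLp (fun x ↦ s x i) 2 μ :=
    (memLp_sign_inner_stdGaussian (g i)).const_mul _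
  have hCs (a : Fin n) : MemLp (fun x ↦ C.mulVec (s x) a) 2 μ :=
    memLp_finsetSum Finset.univ fun i _ ↦ (hs i).const_mul (C a i)
  have hcube (x : EuclideanSpace ℝ (Fin d)) : ∑ a, C.mulVec (s x) a ^ 2 ≤ 1 := by
    refine Real.sqrt_le_one.1 (eucNorm_mulVec_le_one_of_abs_le_one hC fun i ↦ ?_)
    rw [abs_mul, abs_norm]
    exact mul_le_one₀ (eucNorm_eq_norm_toLp (G i) ▸ hG i) (abs_nonneg _) (abs_real_sign_le_one _)
  have hrow (a : Fin n) :
      2 / Real.pi * ∑ j, (C * G) a j ^ 2 ≤ ∫ x, C.mulVec (s x) a ^ 2 ∂μ := by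
    have hbessel := norm_sq_le_integral_sq_of_integral_mul_inner (hCs a)
      (√(2 / Real.pi) • ∑ i, C a i • g i) fun h ↦ by
        have hint (i : Fin k) : Integrable (fun x ↦ C a i * (s x i * ⟪h, x⟫)) μ :=
          ((hs i).integrable_mul (memLp_two_inner_stdGaussian h)).const_mul _
        simp_rw [mulVec, dotProduct, Finset.sum_mul, mul_assoc (C a _)]
        rw [integral_finsetSum _ fun i _ ↦ hint i, real_inner_smul_left, sum_inner,
          Finset.mul_sum]
        refine Finset.sum_congr rfl fun i _ ↦ ?_
        rw [integral_const_mul, integral_norm_mul_sign_inner_mul_inner_stdGaussian,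
          real_inner_smul_left]
        ring
    rw [norm_smul, mul_pow, Real.norm_eq_abs, sq_abs, Real.sq_sqrt (by positivity),
      EuclideanSpace.real_norm_sq_eq] at hbessel
    simpa [g, mul_apply] using hbessel
  have htotal : 2 / Real.pi * ∑ a, ∑ j, (C * G) a j ^ 2 ≤ 1 := by
    calc 2 / Real.pi * ∑ a, ∑ j, (C * G) a j ^ 2
        ≤ ∑ a, ∫ x, C.mulVec (s x) a ^ 2 ∂μ := by
          rw [Finset.mul_sum]
          exact Finset.sum_le_sum fun a _ ↦ hrow a
      _ = ∫ x, ∑ a, C.mulVec (s x) a ^ 2 ∂μ :=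
          (integral_finsetSum _ fun a _ ↦ (hCs a).integrable_sq).symm
      _ ≤ ∫ _, (1 : ℝ) ∂μ :=
          integral_mono (integrable_finsetSum _ fun a _ ↦ (hCs a).integrable_sq)
            (integrable_const 1) hcube
      _ = 1 := by simp [μ]
  rw [div_mul_eq_mul_div, div_le_one Real.pi_pos] at htotal
  linarith

theorem frobenius_bound_of_sign_vectors_pi_div_two
    (n k d : ℕ) (hn : 1 ≤ n) (hk : 1 ≤ k) (hd : 1 ≤ d)
    (C : Matrix (Fin n) (Fin k) ℝ)
    (hC : ∀ u : Fin k → ℝ, (∀ i, u i = 1 ∨ u i = -1) → eucNorm (C.mulVec u) ≤ 1)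
    (G : Matrix (Fin k) (Fin d) ℝ)
    (hG : ∀ i : Fin k, eucNorm (G i) ≤ 1) :
    frobNorm (C * G) ≤ Real.pi / 2 := by
  have hpi : 1 ≤ Real.pi / 2 := by linarith [Real.two_le_pi]
  refine Real.sqrt_le_iff.2 ⟨by positivity, (sum_sq_mul_le_pi_div_two hC hG).trans ?_⟩
  exact le_self_pow₀ hpi two_ne_zero
end

section
/- For every real symmetric k×k matrix X there exists a vector u ∈ {−1, 1}^k such that uᵀXu ≥ tr(X). -/
open Matrix

/-- Splitting off the first coordinate of a quadratic form. -/
theorem vecCons_dotProduct_mulVec_vecCons {R : Type*} [CommRing R] {n : ℕ}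
    (X : Matrix (Fin (n + 1)) (Fin (n + 1)) R) (e : R) (u : Fin n → R) :
    vecCons e u ⬝ᵥ X.mulVec (vecCons e u) =
      e * e * X 0 0 + e * ∑ j : Fin n, (X 0 j.succ * u j + u j * X j.succ 0) +
        u ⬝ᵥ (X.submatrix Fin.succ Fin.succ).mulVec u := by
  simp only [dotProduct, mulVec, Fin.sum_univ_succ, cons_val_zero, cons_val_succ,
    submatrix_apply, mul_add, Finset.sum_add_distrib, Finset.mul_sum]
  have h : ∀ i : Fin n, u i * (X i.succ 0 * e) = e * (u i * X i.succ 0) := fun i => by ring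
  simp only [h]
  ring

/-- Signs can be chosen one coordinate at a time so that the off-diagonal part of the quadratic
form is nonnegative; symmetry of the matrix plays no role. -/
theorem exists_sign_vector_trace_le (n : ℕ) (X : Matrix (Fin n) (Fin n) ℝ) :
    ∃ u : Fin n → ℝ, (∀ i, u i = 1 ∨ u i = -1) ∧ X.trace ≤ u ⬝ᵥ X.mulVec u := by
  induction n with
  | zero => exact ⟨0, fun i => i.elim0, by simp [trace]⟩
  | succ n ih =>
    obtain ⟨u, hu, hle⟩ := ih (X.submatrix Fin.succ Fin.succ)
    have htr : X.trace = X 0 0 + (X.submatrix Fin.succ Fin.succ).trace := by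
      simp [trace, Fin.sum_univ_succ]
    obtain ⟨e, he, hs⟩ : ∃ e : ℝ, (e = 1 ∨ e = -1) ∧
        0 ≤ e * ∑ j : Fin n, (X 0 j.succ * u j + u j * X j.succ 0) := by
      rcases le_total 0 (∑ j : Fin n, (X 0 j.succ * u j + u j * X j.succ 0)) with h | h
      · exact ⟨1, Or.inl rfl, by linarith⟩
      · exact ⟨-1, Or.inr rfl, by linarith⟩
    have hee : e * e = 1 := by rcases he with rfl | rfl <;> norm_num
    refine ⟨vecCons e u, Fin.cases he hu, ?_⟩
    rw [vecCons_dotProduct_mulVec_vecCons, htr, hee]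
    linarith

theorem exists_sign_vector_quadratic_form_ge_trace
    (k : ℕ) (X : Matrix (Fin k) (Fin k) ℝ) (hX : X.IsSymm) :
    ∃ u : Fin k → ℝ, (∀ i, u i = 1 ∨ u i = -1) ∧
      X.trace ≤ u ⬝ᵥ X.mulVec u :=
  exists_sign_vector_trace_le k X
end

section
/- Let C be a real n×n matrix, let Π be a participation schema on {1,…,n}, let d ≥ 1, and suppose every entry of CᵀC is nonnegative. Then the supremum over G ∈ D^d_Π of ‖CG‖_F equals the maximum over u ∈ D¹_Π of ‖Cu‖₂. -/
open Matrix

/-- Membership in `D¹_Π`: vectors with `±1` entries on some participation pattern `π ∈ Π`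
and `0` elsewhere. -/
def memD1 {n : ℕ} (P : Finset (Finset (Fin n))) (u : Fin n → ℝ) : Prop :=
  ∃ π ∈ P, (∀ i ∈ π, u i = 1 ∨ u i = -1) ∧ ∀ i ∉ π, u i = 0

/-- Membership in `D^d_Π`: matrices whose rows on some participation pattern `π ∈ Π` have
Euclidean norm at most `1` and whose other rows vanish. -/
def memDd {n d : ℕ} (P : Finset (Finset (Fin n))) (G : Matrix (Fin n) (Fin d) ℝ) : Prop :=
  ∃ π ∈ P, (∀ i ∈ π, eucNorm (G i) ≤ 1) ∧ ∀ i ∉ π, G i = 0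

/-- The squared Euclidean norm of `C v` is the quadratic form of the Gram matrix `Cᵀ C` at `v`. -/
theorem sum_sq_mulVec_eq_gram {n : ℕ} (C : Matrix (Fin n) (Fin n) ℝ) (v : Fin n → ℝ) :
    ∑ i, (C.mulVec v i) ^ 2 = ∑ a, ∑ b, (Cᵀ * C) a b * (v a * v b) := by
  have h : ∑ i, (C.mulVec v i) ^ 2 = v ⬝ᵥ (Cᵀ * C).mulVec v := by
    rw [← Matrix.mulVec_mulVec, Matrix.dotProduct_mulVec, Matrix.vecMul_transpose]
    simp only [dotProduct, sq]
  rw [h]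
  simp only [dotProduct, Matrix.mulVec, Finset.mul_sum]
  exact Finset.sum_congr rfl fun a _ => Finset.sum_congr rfl fun b _ => by ring

/-- The squared Frobenius norm of `C G` pairs the Gram matrices of `C` and of the rows of `G`. -/
theorem sum_sq_mul_eq_gram {n d : ℕ} (C : Matrix (Fin n) (Fin n) ℝ)
    (G : Matrix (Fin n) (Fin d) ℝ) :
    ∑ i, ∑ j, ((C * G) i j) ^ 2 = ∑ a, ∑ b, (Cᵀ * C) a b * ∑ j, G a j * G b j := by
  rw [Finset.sum_comm]
  have h : ∀ j, ∑ i, ((C * G) i j) ^ 2 =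
      ∑ a, ∑ b, (Cᵀ * C) a b * (G a j * G b j) := fun j =>
    sum_sq_mulVec_eq_gram C fun a => G a j
  simp only [h, Finset.mul_sum]
  rw [Finset.sum_comm]
  exact Finset.sum_congr rfl fun a _ => Finset.sum_comm

theorem sum_mul_le_one_of_eucNorm_le_one {d : ℕ} {x y : Fin d → ℝ}
    (hx : eucNorm x ≤ 1) (hy : eucNorm y ≤ 1) : ∑ j, x j * y j ≤ 1 :=
  (Real.sum_mul_le_sqrt_mul_sqrt _ x y).trans
    (mul_le_one₀ hx (Real.sqrt_nonneg _) hy)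

/-- The `0`/`1` indicator vector of a participation pattern. -/
def patternIndicator {n : ℕ} (π : Finset (Fin n)) (i : Fin n) : ℝ :=
  if i ∈ π then 1 else 0

theorem memD1_patternIndicator {n : ℕ} {P : Finset (Finset (Fin n))} {π : Finset (Fin n)}
    (hπ : π ∈ P) : memD1 P (patternIndicator π) :=
  ⟨π, hπ, fun i hi => Or.inl (by simp [patternIndicator, hi]),
    fun i hi => by simp [patternIndicator, hi]⟩

/-- With a nonnegative Gram matrix, the indicator vector of a pattern dominates every matrix
supported on that pattern with rows in the unit ball. -/
theorem frobNorm_mul_le_eucNorm_patternIndicator {n d : ℕ} {C : Matrix (Fin n) (Fin n) ℝ}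
    (hCC : ∀ i j, 0 ≤ (Cᵀ * C) i j) {π : Finset (Fin n)} {G : Matrix (Fin n) (Fin d) ℝ}
    (hG : ∀ i ∈ π, eucNorm (G i) ≤ 1) (hG0 : ∀ i ∉ π, G i = 0) :
    frobNorm (C * G) ≤ eucNorm (C.mulVec (patternIndicator π)) := by
  refine Real.sqrt_le_sqrt ?_
  rw [sum_sq_mul_eq_gram, sum_sq_mulVec_eq_gram]
  refine Finset.sum_le_sum fun a _ => Finset.sum_le_sum fun b _ =>
    mul_le_mul_of_nonneg_left ?_ (hCC a b)
  by_cases ha : a ∈ π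
  · by_cases hb : b ∈ π
    · simpa [patternIndicator, ha, hb] using
        sum_mul_le_one_of_eucNorm_le_one (hG a ha) (hG b hb)
    · simp [patternIndicator, hb, hG0 b hb]
  · simp [patternIndicator, ha, hG0 a ha]

/-- Placing a vector of `D¹_Π` in a single column gives a matrix of `D^d_Π` with the same norm
after multiplication by `C`. -/
theorem exists_memDd_frobNorm_eq {n d : ℕ} (hd : 1 ≤ d) {P : Finset (Finset (Fin n))}
    (C : Matrix (Fin n) (Fin n) ℝ) {u : Fin n → ℝ} (hu : memD1 P u) :
    ∃ G : Matrix (Fin n) (Fin d) ℝ, memDd P G ∧ frobNorm (C * G) = eucNorm (C.mulVec u) := by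
  obtain ⟨π, hπ, h1, h0⟩ := hu
  let k : Fin d := ⟨0, hd⟩
  refine ⟨Matrix.of fun i => Pi.single k (u i), ⟨π, hπ, fun i hi => ?_, fun i hi => ?_⟩, ?_⟩
  · rcases h1 i hi with h | h <;> simp [eucNorm, h, Pi.single_apply]
  · exact funext fun j => by simp [h0 i hi]
  · unfold frobNorm eucNorm
    rw [sum_sq_mul_eq_gram, sum_sq_mulVec_eq_gram]
    simp [Pi.single_apply]

theorem matrix_sensitivity_eq_vector_sensitivity_of_nonneg_gram
    (n d : ℕ) (hd : 1 ≤ d)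
    (P : Finset (Finset (Fin n))) (hP : P.Nonempty) (hPne : ∀ π ∈ P, π.Nonempty)
    (C : Matrix (Fin n) (Fin n) ℝ)
    (hCC : ∀ i j, 0 ≤ (Cᵀ * C) i j) :
    sSup {x : ℝ | ∃ G : Matrix (Fin n) (Fin d) ℝ, memDd P G ∧ x = frobNorm (C * G)} =
      sSup {x : ℝ | ∃ u : Fin n → ℝ, memD1 P u ∧ x = eucNorm (C.mulVec u)} ∧
    ∃ u : Fin n → ℝ, memD1 P u ∧
      eucNorm (C.mulVec u) =
        sSup {x : ℝ | ∃ u : Fin n → ℝ, memD1 P u ∧ x = eucNorm (C.mulVec u)} := by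
  obtain ⟨π, hπ, hmax⟩ := P.exists_max_image
    (fun π => eucNorm (C.mulVec (patternIndicator π))) hP
  have hDd : ∀ G : Matrix (Fin n) (Fin d) ℝ, memDd P G →
      frobNorm (C * G) ≤ eucNorm (C.mulVec (patternIndicator π)) := by
    rintro G ⟨ρ, hρ, hG, hG0⟩
    exact (frobNorm_mul_le_eucNorm_patternIndicator hCC hG hG0).trans (hmax ρ hρ)
  have hgreatest_d : IsGreatest
      {x : ℝ | ∃ G : Matrix (Fin n) (Fin d) ℝ, memDd P G ∧ x = frobNorm (C * G)}
      (eucNorm (C.mulVec (patternIndicator π))) := by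
    refine ⟨?_, ?_⟩
    · obtain ⟨G, hG, h⟩ := exists_memDd_frobNorm_eq hd C (memD1_patternIndicator hπ)
      exact ⟨G, hG, h.symm⟩
    · rintro x ⟨G, hG, rfl⟩
      exact hDd G hG
  have hgreatest_one : IsGreatest
      {x : ℝ | ∃ u : Fin n → ℝ, memD1 P u ∧ x = eucNorm (C.mulVec u)}
      (eucNorm (C.mulVec (patternIndicator π))) := by
    refine ⟨⟨_, memD1_patternIndicator hπ, rfl⟩, ?_⟩
    rintro x ⟨u, hu, rfl⟩
    obtain ⟨G, hG, h⟩ := exists_memDd_frobNorm_eq hd C hu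
    exact h ▸ hDd G hG
  exact ⟨hgreatest_d.csSup_eq.trans hgreatest_one.csSup_eq.symm,
    _, memD1_patternIndicator hπ, hgreatest_one.csSup_eq.symm⟩
end

section
/- Let C be a real n×n matrix such that every entry of X := CᵀC is nonnegative, and let Π be a participation schema on {1,…,n}. Then the maximum over u ∈ D¹_Π of uᵀXu equals the maximum over π ∈ Π of Σ_{i ∈ π} Σ_{j ∈ π} X_{ij}; equivalently, the maximum over u ∈ D¹_Π of ‖Cu‖₂ equals the maximum over π ∈ Π of the square root of the sum of all entries of the submatrix X[π, π]. -/
open Matrix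

/-- A quadratic form evaluated at the indicator of `π` is the sum of the entries of the
submatrix indexed by `π`. -/
theorem dotProduct_mulVec_indicator {ι : Type*} [Fintype ι] [DecidableEq ι]
    (X : Matrix ι ι ℝ) (π : Finset ι) :
    (fun i => if i ∈ π then (1 : ℝ) else 0) ⬝ᵥ X.mulVec (fun i => if i ∈ π then (1 : ℝ) else 0) =
      ∑ i ∈ π, ∑ j ∈ π, X i j := by
  simp [dotProduct, mulVec]

theorem dotProduct_mulVec_le_of_abs_le {ι : Type*} [Fintype ι] {X : Matrix ι ι ℝ}
    (hX : ∀ i j, 0 ≤ X i j) {u v : ι → ℝ} (huv : ∀ i, |u i| ≤ v i) :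
    u ⬝ᵥ X.mulVec u ≤ v ⬝ᵥ X.mulVec v := by
  simp only [dotProduct, mulVec, Finset.mul_sum]
  refine Finset.sum_le_sum fun i _ => Finset.sum_le_sum fun j _ => ?_
  have huv_mul : u i * u j ≤ v i * v j :=
    (le_abs_self _).trans <| (abs_mul _ _).trans_le <|
      mul_le_mul (huv i) (huv j) (abs_nonneg _) ((abs_nonneg _).trans (huv i))
  calc u i * (X i j * u j) = X i j * (u i * u j) := by ring
    _ ≤ X i j * (v i * v j) := mul_le_mul_of_nonneg_left huv_mul (hX i j)
    _ = v i * (X i j * v j) := by ring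

theorem eucNorm_mulVec {m n : ℕ} (C : Matrix (Fin m) (Fin n) ℝ) (u : Fin n → ℝ) :
    eucNorm (C.mulVec u) = Real.sqrt (u ⬝ᵥ (Cᵀ * C).mulVec u) := by
  rw [← mulVec_mulVec, dotProduct_mulVec, vecMul_transpose]
  simp [eucNorm, dotProduct, sq]

/-- For an entrywise nonnegative matrix, a monotone function of the quadratic form is maximized
over `D¹_Π` at the indicator of a participation pattern. -/
theorem sSup_monotone_quadratic_form_memD1 {n : ℕ} {P : Finset (Finset (Fin n))}
    (hP : P.Nonempty) {X : Matrix (Fin n) (Fin n) ℝ} (hX : ∀ i j, 0 ≤ X i j)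
    {f : ℝ → ℝ} (hf : Monotone f) :
    sSup {x : ℝ | ∃ u : Fin n → ℝ, memD1 P u ∧ x = f (u ⬝ᵥ X.mulVec u)} =
      P.sup' hP (fun π => f (∑ i ∈ π, ∑ j ∈ π, X i j)) := by
  refine IsGreatest.csSup_eq ⟨?_, ?_⟩
  · obtain ⟨π, hπ, hmax⟩ := P.exists_mem_eq_sup' hP (fun π => f (∑ i ∈ π, ∑ j ∈ π, X i j))
    refine ⟨fun i => if i ∈ π then 1 else 0, ⟨π, hπ, ?_, ?_⟩, ?_⟩
    · intro i hi
      simp [hi]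
    · intro i hi
      simp [hi]
    · rw [hmax, dotProduct_mulVec_indicator]
  · rintro _ ⟨u, ⟨π, hπ, hu_on, hu_off⟩, rfl⟩
    refine le_trans (hf ?_) (Finset.le_sup' (fun π => f (∑ i ∈ π, ∑ j ∈ π, X i j)) hπ)
    rw [← dotProduct_mulVec_indicator]
    refine dotProduct_mulVec_le_of_abs_le hX fun i => ?_
    by_cases hi : i ∈ π
    · rcases hu_on i hi with h | h <;> simp [hi, h]
    · simp [hi, hu_off i hi]

theorem sensitivity_brute_force_of_nonneg_gram
    (n : ℕ) (P : Finset (Finset (Fin n))) (hP : P.Nonempty) (hPne : ∀ π ∈ P, π.Nonempty)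
    (C : Matrix (Fin n) (Fin n) ℝ)
    (hX : ∀ i j, 0 ≤ (Cᵀ * C) i j) :
    sSup {x : ℝ | ∃ u : Fin n → ℝ, memD1 P u ∧ x = u ⬝ᵥ (Cᵀ * C).mulVec u} =
      P.sup' hP (fun π => ∑ i ∈ π, ∑ j ∈ π, (Cᵀ * C) i j) ∧
    sSup {x : ℝ | ∃ u : Fin n → ℝ, memD1 P u ∧ x = eucNorm (C.mulVec u)} =
      P.sup' hP (fun π => Real.sqrt (∑ i ∈ π, ∑ j ∈ π, (Cᵀ * C) i j)) := by
  refine ⟨sSup_monotone_quadratic_form_memD1 hP hX monotone_id, ?_⟩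
  simp only [eucNorm_mulVec]
  exact sSup_monotone_quadratic_form_memD1 hP hX fun _ _ h => Real.sqrt_le_sqrt h
end

section
/- Let N ≥ 1, let F be the N×N complex matrix with entries F_{k,a} = exp(−2πi·k·a/N)/√N (the unitary discrete Fourier transform matrix), let v ∈ ℝ^N, and let v̂ ∈ ℂ^N be given by v̂(m) = Σ_{a=0}^{N−1} v_a · exp(−2πi·m·a/N). Suppose that no entry v̂(m) is a negative real number. Then every entry of the matrix F* · diag(√(v̂(0)),…,√(v̂(N−1))) · F is real, where √ denotes the principal branch of the complex square root and F* the conjugate transpose of F. -/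
open Matrix Complex

/-- The unitary discrete Fourier transform matrix of size `N`. -/
noncomputable def dftMatrix (N : ℕ) : Matrix (Fin N) (Fin N) ℂ :=
  Matrix.of fun k a : Fin N =>
    Complex.exp (-2 * Real.pi * Complex.I * (k : ℕ) * (a : ℕ) / N) / Real.sqrt N

/-- The (unnormalized) discrete Fourier transform of the real vector `v`, evaluated at
frequency `m`. -/
noncomputable def dft {N : ℕ} (v : Fin N → ℝ) (m : Fin N) : ℂ :=
  ∑ a : Fin N, (v a : ℂ) * Complex.exp (-2 * Real.pi * Complex.I * (m : ℕ) * (a : ℕ) / N)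

/-- The characters of `ℤ/N` at opposite frequencies are complex conjugate. -/
theorem exp_neg_frequency {N : ℕ} [NeZero N] (m a : Fin N) :
    Complex.exp (-2 * Real.pi * Complex.I * ((-m : Fin N) : ℕ) * (a : ℕ) / N) =
      (starRingEnd ℂ) (Complex.exp (-2 * Real.pi * Complex.I * (m : ℕ) * (a : ℕ) / N)) := by
  have hN : (N : ℂ) ≠ 0 := Nat.cast_ne_zero.mpr (NeZero.ne N)
  obtain ⟨q, hq⟩ : ∃ q : ℕ, ((-m : Fin N) : ℕ) + (m : ℕ) = q * N := by
    have h : (((-m + m : Fin N)) : ℕ) = 0 := by simp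
    rw [Fin.val_add] at h
    obtain ⟨q, hq⟩ := Nat.dvd_of_mod_eq_zero h
    exact ⟨q, by rw [hq, mul_comm]⟩
  have hm : (((-m : Fin N) : ℕ) : ℂ) = q * N - (m : ℕ) := by
    rw [eq_sub_iff_add_eq]
    exact_mod_cast hq
  rw [← Complex.exp_conj, Complex.exp_eq_exp_iff_exists_int]
  refine ⟨-(q * (a : ℕ) : ℤ), ?_⟩
  simp only [map_div₀, map_mul, map_neg, map_ofNat, Complex.conj_ofReal, Complex.conj_I,
    map_natCast, hm]
  push_cast
  field_simp
  ring

theorem dft_neg {N : ℕ} [NeZero N] (v : Fin N → ℝ) (m : Fin N) :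
    dft v (-m) = (starRingEnd ℂ) (dft v m) := by
  simp only [dft, map_sum, map_mul, Complex.conj_ofReal, exp_neg_frequency]

theorem dftMatrix_neg {N : ℕ} [NeZero N] (m a : Fin N) :
    dftMatrix N (-m) a = (starRingEnd ℂ) (dftMatrix N m a) := by
  simp only [dftMatrix, Matrix.of_apply, map_div₀, Complex.conj_ofReal, exp_neg_frequency]

theorem real_sqrt_convolution
    (N : ℕ) (hN : 1 ≤ N) (v : Fin N → ℝ)
    (hv : ∀ m : Fin N, ¬((dft v m).im = 0 ∧ (dft v m).re < 0)) :
    ∀ k a : Fin N,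
      (((dftMatrix N)ᴴ * Matrix.diagonal (fun m => dft v m ^ ((1 : ℂ) / 2)) * dftMatrix N)
        k a).im = 0 := by
  intro k a
  have : NeZero N := ⟨by omega⟩
  have hsqrt (m : Fin N) : dft v (-m) ^ ((1 : ℂ) / 2) =
      (starRingEnd ℂ) (dft v m ^ ((1 : ℂ) / 2)) := by
    have harg : (dft v m).arg ≠ Real.pi := fun h =>
      hv m (Complex.arg_eq_pi_iff.mp h).symm
    rw [dft_neg, Complex.conj_cpow _ _ harg]
    simp only [map_div₀, map_one, map_ofNat]
  rw [← Complex.conj_eq_iff_im, Matrix.mul_apply]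
  simp only [Matrix.mul_diagonal, Matrix.conjTranspose_apply, map_sum, map_mul]
  rw [← Equiv.sum_comp (Equiv.neg (Fin N))]
  simp only [Equiv.neg_apply, dftMatrix_neg, hsqrt, RCLike.star_def, Complex.conj_conj]
end
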